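/- Let r, h ∈ ℝ with r² > h² > 0 and let α: ℝ → ℝ³ be the circular helix α(s) = (r cos φ(s), r sin φ(s), h φ(s)) with φ(s) = s/√(r² − h²). Let β: J → ℝ³ be a unit-speed spacelike curve on an open interval J such that det(α'(s), β'(t), α''(s)) + det(α'(s), β'(t), β''(t)) = 0 for all (s,t) ∈ ℝ × J. Then β is, up to orientation of the parameter, a translate of the same helix: there exist σ ∈ {−1, 1}, t₀ ∈ ℝ and v ∈ ℝ³ such that β(t) = α(σ t + t₀) + v for all t ∈ J. -/

import Mathlib

open Real

noncomputable def lprod (u v : Fin 3 → ℝ) : ℝ :=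
  u 0 * v 0 + u 1 * v 1 - u 2 * v 2

noncomputable def det3 (u v w : Fin 3 → ℝ) : ℝ :=
  u 0 * (v 1 * w 2 - v 2 * w 1) - u 1 * (v 0 * w 2 - v 2 * w 0) +
    u 2 * (v 0 * w 1 - v 1 * w 0)

/-- A point of the unit circle is of the form `(cos θ, sin θ)`. -/
theorem exists_cos_sin_eq {a b : ℝ} (hab : a ^ 2 + b ^ 2 = 1) :
    ∃ θ : ℝ, Real.cos θ = a ∧ Real.sin θ = b := by
  have hn : ‖(⟨a, b⟩ : ℂ)‖ = 1 := by
    rw [Complex.norm_def, Complex.normSq_mk, Real.sqrt_eq_one]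
    linarith
  have h0 : (⟨a, b⟩ : ℂ) ≠ 0 := by
    intro h
    simp [h] at hn
  refine ⟨Complex.arg ⟨a, b⟩, ?_, ?_⟩
  · rw [Complex.cos_arg h0, hn, div_one]
  · rw [Complex.sin_arg, hn, div_one]

/-- The velocity of the helix `s ↦ (r cos (k s), r sin (k s), h k s)`. -/
theorem hasDerivAt_helix (r h k s : ℝ) :
    HasDerivAt (fun s : ℝ => ![r * Real.cos (k * s), r * Real.sin (k * s), h * (k * s)])
      ![-(r * k * Real.sin (k * s)), r * k * Real.cos (k * s), h * k] s := by
  have hk : HasDerivAt (fun s : ℝ => k * s) k s := by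
    simpa using (hasDerivAt_id s).const_mul k
  rw [hasDerivAt_pi]
  intro i
  fin_cases i
  · simpa using (hk.cos.const_mul r).congr_deriv (by ring)
  · simpa using (hk.sin.const_mul r).congr_deriv (by ring)
  · simpa using hk.const_mul h

/-- The acceleration of the helix `s ↦ (r cos (k s), r sin (k s), h k s)`. -/
theorem hasDerivAt_helix_velocity (r h k s : ℝ) :
    HasDerivAt (fun s : ℝ => ![-(r * k * Real.sin (k * s)), r * k * Real.cos (k * s), h * k])
      ![-(r * k ^ 2 * Real.cos (k * s)), -(r * k ^ 2 * Real.sin (k * s)), 0] s := by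
  have hk : HasDerivAt (fun s : ℝ => k * s) k s := by
    simpa using (hasDerivAt_id s).const_mul k
  rw [hasDerivAt_pi]
  intro i
  fin_cases i
  · simpa using ((hk.sin.const_mul (r * k)).fun_neg).congr_deriv (by ring)
  · simpa using (hk.cos.const_mul (r * k)).congr_deriv (by ring)
  · simpa using hasDerivAt_const s (h * k)

/-- The harmonic system `x' = -ω y`, `y' = ω x` on an interval has at most one solution with
given initial value. -/
theorem rotation_system_unique {J : Set ℝ} (hJo : IsOpen J) (hJc : IsPreconnected J) {ω τ : ℝ}
    (hτ : τ ∈ J) {x y X Y : ℝ → ℝ}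
    (hx : ∀ t ∈ J, HasDerivAt x (-(ω * y t)) t) (hy : ∀ t ∈ J, HasDerivAt y (ω * x t) t)
    (hX : ∀ t ∈ J, HasDerivAt X (-(ω * Y t)) t) (hY : ∀ t ∈ J, HasDerivAt Y (ω * X t) t)
    (hxτ : x τ = X τ) (hyτ : y τ = Y τ) {t : ℝ} (ht : t ∈ J) : x t = X t ∧ y t = Y t := by
  have hE : ∀ t ∈ J, HasDerivAt (fun t => (x t - X t) ^ 2 + (y t - Y t) ^ 2) 0 t := by
    intro t ht
    refine ((((hx t ht).sub (hX t ht)).pow 2).add (((hy t ht).sub (hY t ht)).pow 2)).congr_deriv ?_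
    simp only [Pi.sub_apply]
    ring
  have hconst := hJo.is_const_of_deriv_eq_zero hJc
    (fun t ht => (hE t ht).differentiableAt.differentiableWithinAt)
    (fun t ht => (hE t ht).deriv) ht hτ
  simp only [hxτ, hyτ, sub_self] at hconst
  constructor <;> nlinarith [sq_nonneg (x t - X t), sq_nonneg (y t - Y t)]

/-- The maximality equation for the pair consisting of the helix and a unit vector `(x, y, z)`
with derivative `(x', y', z')` forces the height of the vector and its rotation law. -/
theorem helix_maximality_consequences {r h k x y z x' y' z' : ℝ} (hr : r ≠ 0)
    (hk : 0 < k) (hk2 : k ^ 2 * (r ^ 2 - h ^ 2) = 1) (hu : x * x + y * y - z * z = 1)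
    (hE : ∀ s : ℝ,
      det3 ![-(r * k * Real.sin (k * s)), r * k * Real.cos (k * s), h * k] ![x, y, z]
          ![-(r * k ^ 2 * Real.cos (k * s)), -(r * k ^ 2 * Real.sin (k * s)), 0] +
        det3 ![-(r * k * Real.sin (k * s)), r * k * Real.cos (k * s), h * k] ![x, y, z]
          ![x', y', z'] = 0) :
    z ^ 2 = (h * k) ^ 2 ∧ z * y' - y * z' = h * k ^ 2 * x ∧
      z * x' - x * z' = -(h * k ^ 2 * y) := by
  have e0 := hE 0
  have e1 := hE (π / k)
  have e2 := hE (π / 2 / k)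
  have q1 : k * (π / k) = π := by field_simp
  have q2 : k * (π / 2 / k) = π / 2 := by field_simp
  simp only [det3, q1, q2, mul_zero, Real.sin_zero, Real.cos_zero, Real.sin_pi, Real.cos_pi,
    Real.sin_pi_div_two, Real.cos_pi_div_two, Matrix.cons_val] at e0 e1 e2
  have hA : h * (x * y' - y * x') = k ^ 2 * r ^ 2 * z := by
    apply mul_left_cancel₀ hk.ne'
    linear_combination (e0 + e1) / 2
  have hC : z * x' - x * z' = -(h * k ^ 2 * y) := by
    apply mul_left_cancel₀ (mul_ne_zero hr hk.ne')
    linear_combination (e0 - e1) / 2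
  have hB : z * y' - y * z' = h * k ^ 2 * x := by
    apply mul_left_cancel₀ (mul_ne_zero hr hk.ne')
    linear_combination e2 - (e0 + e1) / 2
  refine ⟨?_, hB, hC⟩
  have key : k ^ 2 * (r ^ 2 * z ^ 2 - h ^ 2 * (x ^ 2 + y ^ 2)) = 0 := by
    linear_combination (-z) * hA + h * x * hB - h * y * hC
  linear_combination key - z ^ 2 * hk2 + k ^ 2 * h ^ 2 * hu

/-- if one generating curve of a maximal translation surface is the
circular helix of type I, the other generating curve is, up to orientation of the
parameter, a translate of the same helix. -/
theorem stmt_13 (r h : ℝ) (h1 : h ^ 2 < r ^ 2) (h2 : 0 < h ^ 2)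
    (φ : ℝ → ℝ) (hφ : ∀ s, φ s = s / Real.sqrt (r ^ 2 - h ^ 2))
    (α : ℝ → Fin 3 → ℝ)
    (hα : ∀ s, α s = ![r * Real.cos (φ s), r * Real.sin (φ s), h * φ s])
    (J : Set ℝ) (hJo : IsOpen J) (hJc : Convex ℝ J)
    (β : ℝ → Fin 3 → ℝ)
    (hβsm : ContDiffOn ℝ (⊤ : ℕ∞) β J)
    (hβu : ∀ t ∈ J, lprod (deriv β t) (deriv β t) = 1)
    (hmax : ∀ s : ℝ, ∀ t ∈ J,
      det3 (deriv α s) (deriv β t) (deriv (deriv α) s) +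
        det3 (deriv α s) (deriv β t) (deriv (deriv β) t) = 0) :
    ∃ (σ : ℝ), (σ = 1 ∨ σ = -1) ∧ ∃ (t₀ : ℝ) (v : Fin 3 → ℝ),
      ∀ t ∈ J, β t = α (σ * t + t₀) + v := by
  rcases J.eq_empty_or_nonempty with rfl | ⟨τ, hτ⟩
  · exact ⟨1, Or.inl rfl, 0, 0, fun t ht => ht.elim⟩
  have hJp : IsPreconnected J := hJc.isPreconnected
  have hr : r ≠ 0 := by rintro rfl; nlinarith
  have hh : h ≠ 0 := by rintro rfl; simp at h2
  obtain ⟨k, hk, hk2, hφk⟩ : ∃ k : ℝ, 0 < k ∧ k ^ 2 * (r ^ 2 - h ^ 2) = 1 ∧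
      ∀ s, φ s = k * s := by
    have hd : 0 < r ^ 2 - h ^ 2 := by linarith
    refine ⟨(Real.sqrt (r ^ 2 - h ^ 2))⁻¹, by positivity, ?_, fun s => ?_⟩
    · rw [inv_pow, Real.sq_sqrt hd.le, inv_mul_cancel₀ hd.ne']
    · rw [hφ, div_eq_inv_mul]
  obtain rfl : α = fun s => ![r * Real.cos (k * s), r * Real.sin (k * s), h * (k * s)] := by
    funext s
    rw [hα, hφk]
  have hα1 := funext fun s => (hasDerivAt_helix r h k s).deriv
  have hα2 := fun s => (hasDerivAt_helix_velocity r h k s).deriv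
  have hβ1 : ∀ t ∈ J, HasDerivAt β (deriv β t) t := fun t ht =>
    ((hβsm.differentiableOn (by simp)).differentiableAt (hJo.mem_nhds ht)).hasDerivAt
  have hβ2 : ∀ t ∈ J, HasDerivAt (deriv β) (deriv (deriv β) t) t := fun t ht =>
    ((((contDiffOn_infty_iff_deriv_of_isOpen hJo).1 hβsm).2.differentiableOn
      (by simp)).differentiableAt (hJo.mem_nhds ht)).hasDerivAt
  set B := deriv β with hB
  have hcoord : ∀ i, ∀ t ∈ J, HasDerivAt (fun t => B t i) (deriv B t i) t :=
    fun i t ht => hasDerivAt_pi.1 (hβ2 t ht) i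
  have hvec : ∀ w : Fin 3 → ℝ, w = ![w 0, w 1, w 2] := by
    intro w
    ext i
    fin_cases i <;> rfl
  have hcons : ∀ t ∈ J, B t 2 ^ 2 = (h * k) ^ 2 ∧
      B t 2 * deriv B t 1 - B t 1 * deriv B t 2 = h * k ^ 2 * B t 0 ∧
      B t 2 * deriv B t 0 - B t 0 * deriv B t 2 = -(h * k ^ 2 * B t 1) := by
    intro t ht
    refine helix_maximality_consequences hr hk hk2 (hβu t ht) fun s => ?_
    have := hmax s t ht
    rw [hα1, hα2] at this
    rwa [← hvec, ← hvec]
  have hhk : h * k ≠ 0 := mul_ne_zero hh hk.ne'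
  have hz0 : ∀ t ∈ J, B t 2 ≠ 0 := fun t ht h0 => by
    have := (hcons t ht).1
    rw [h0] at this
    exact pow_ne_zero 2 hhk (by linarith)
  have hz' : ∀ t ∈ J, deriv B t 2 = 0 := by
    intro t ht
    have hsq : HasDerivAt (fun t => B t 2 ^ 2) 0 t :=
      (hasDerivAt_const t ((h * k) ^ 2)).congr_of_eventuallyEq
        (Filter.eventuallyEq_of_mem (hJo.mem_nhds ht) fun t ht => (hcons t ht).1)
    have := ((hcoord 2 t ht).pow 2).unique hsq
    simpa [hz0 t ht] using this
  have hzc : ∀ t ∈ J, B t 2 = B τ 2 := fun t ht =>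
    hJo.is_const_of_deriv_eq_zero hJp
      (fun t ht => (hcoord 2 t ht).differentiableAt.differentiableWithinAt)
      (fun t ht => (hcoord 2 t ht).deriv.trans (hz' t ht)) ht hτ
  obtain ⟨σ, hσ, hzσ⟩ : ∃ σ : ℝ, (σ = 1 ∨ σ = -1) ∧ B τ 2 = σ * (h * k) := by
    rcases sq_eq_sq_iff_eq_or_eq_neg.1 (hcons τ hτ).1 with hz | hz
    · exact ⟨1, Or.inl rfl, by linarith⟩
    · exact ⟨-1, Or.inr rfl, by linarith⟩
  have hσ2 : σ * σ = 1 := by rcases hσ with rfl | rfl <;> norm_num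
  have hσ0 : σ ≠ 0 := by rintro rfl; simp at hσ2
  have hx : ∀ t ∈ J, HasDerivAt (fun t => B t 0) (-(σ * k * B t 1)) t := by
    intro t ht
    refine (hcoord 0 t ht).congr_deriv (mul_left_cancel₀ (mul_ne_zero hσ0 hhk) ?_)
    have := (hcons t ht).2.2
    rw [hz' t ht, hzc t ht, hzσ] at this
    linear_combination this + h * k ^ 2 * B t 1 * hσ2
  have hy : ∀ t ∈ J, HasDerivAt (fun t => B t 1) (σ * k * B t 0) t := by
    intro t ht
    refine (hcoord 1 t ht).congr_deriv (mul_left_cancel₀ (mul_ne_zero hσ0 hhk) ?_)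
    have := (hcons t ht).2.1
    rw [hz' t ht, hzc t ht, hzσ] at this
    linear_combination this - h * k ^ 2 * B t 0 * hσ2
  obtain ⟨θ, hcos, hsin⟩ :
      ∃ θ : ℝ, Real.cos θ = σ * B τ 1 / (r * k) ∧ Real.sin θ = -(σ * B τ 0) / (r * k) := by
    apply exists_cos_sin_eq
    have hu := hβu τ hτ
    simp only [lprod, hzσ] at hu
    have hk0 := hk.ne'
    field_simp
    linear_combination (B τ 1 ^ 2 + B τ 0 ^ 2 + h ^ 2 * k ^ 2) * hσ2 + hu - hk2
  obtain ⟨t₀, ht₀⟩ : ∃ t₀, k * (σ * τ + t₀) = θ :=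
    ⟨θ / k - σ * τ, by field_simp; ring⟩
  have haff : ∀ t, HasDerivAt (fun t => σ * t + t₀) σ t := fun t => by
    simpa using ((hasDerivAt_id t).const_mul σ).add_const t₀
  have hvel : ∀ t, HasDerivAt (fun t => σ • ![-(r * k * Real.sin (k * (σ * t + t₀))),
      r * k * Real.cos (k * (σ * t + t₀)), h * k]) (σ • σ •
      ![-(r * k ^ 2 * Real.cos (k * (σ * t + t₀))),
        -(r * k ^ 2 * Real.sin (k * (σ * t + t₀))), 0]) t := fun t =>
    ((hasDerivAt_helix_velocity r h k (σ * t + t₀)).scomp t (haff t)).const_smul σ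
  have hBα : ∀ t ∈ J, B t = σ • ![-(r * k * Real.sin (k * (σ * t + t₀))),
      r * k * Real.cos (k * (σ * t + t₀)), h * k] := by
    intro t ht
    have hrk : r * k ≠ 0 := mul_ne_zero hr hk.ne'
    obtain ⟨e0, e1⟩ := rotation_system_unique hJo hJp hτ hx hy
      (X := fun t => σ * -(r * k * Real.sin (k * (σ * t + t₀))))
      (Y := fun t => σ * (r * k * Real.cos (k * (σ * t + t₀))))
      (fun t _ => (hasDerivAt_pi.1 (hvel t) 0).congr_deriv (by simp; ring))
      (fun t _ => (hasDerivAt_pi.1 (hvel t) 1).congr_deriv (by simp; ring))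
      (by
        simp only [ht₀, hsin]
        field_simp
        linear_combination -B τ 0 * hσ2)
      (by
        simp only [ht₀, hcos]
        field_simp
        linear_combination -B τ 1 * hσ2) ht
    rw [hvec (B t), e0, e1, hzc t ht, hzσ]
    simp
  have hhelix : ∀ t, HasDerivAt (fun t => ![r * Real.cos (k * (σ * t + t₀)),
      r * Real.sin (k * (σ * t + t₀)), h * (k * (σ * t + t₀))])
      (σ • ![-(r * k * Real.sin (k * (σ * t + t₀))),
        r * k * Real.cos (k * (σ * t + t₀)), h * k]) t := fun t =>
    ((hasDerivAt_helix r h k (σ * t + t₀)).scomp t (haff t) :)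
  have hdiff : ∀ t ∈ J, HasDerivAt (fun t => β t - ![r * Real.cos (k * (σ * t + t₀)),
      r * Real.sin (k * (σ * t + t₀)), h * (k * (σ * t + t₀))]) 0 t := fun t ht =>
    ((hβ1 t ht).fun_sub (hhelix t)).congr_deriv (by rw [hBα t ht, sub_self])
  obtain ⟨v, hv⟩ := hJo.exists_is_const_of_deriv_eq_zero hJp
    (fun t ht => (hdiff t ht).differentiableAt.differentiableWithinAt)
    (fun t ht => (hdiff t ht).deriv)
  exact ⟨σ, hσ, t₀, v, fun t ht => sub_eq_iff_eq_add'.1 (hv t ht)⟩
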